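/- arXiv:1310.4436 — 3 statements merged into one kernel-verified Lean document; each statement's English description precedes it below -/
import Mathlib

section
/- Let \(\mathsf{D}\) be a \(\Gamma\)-graded division ring and let \(\mathsf{A},\mathsf{B}\subseteq\mathsf{D}\) be graded subrings that are graded division rings, with \(\mathsf{D}\) totally ramified over \(\mathsf{B}\). Then the grade group of \(\mathsf{A}\cap\mathsf{B}\) equals \(\Gamma_{\mathsf{A}}\cap\Gamma_{\mathsf{B}}\). -/
noncomputable section

namespace GradedDivPaper

variable {Γ : Type*} [AddCommGroup Γ] [DecidableEq Γ]
variable {D : Type*} [Ring D]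

/-- The (additive) group `Γ` is torsion-free. -/
def TorsionFree (Γ : Type*) [AddCommGroup Γ] : Prop :=
  ∀ (γ : Γ) (n : ℕ), n ≠ 0 → n • γ = 0 → γ = 0

/-- A `Γ`-graded ring is a graded division ring if `1 ≠ 0` and every nonzero
homogeneous element is a unit. -/
def IsGradedDivisionRing (𝒜 : Γ → AddSubgroup D) [GradedRing 𝒜] : Prop :=
  (0 : D) ≠ 1 ∧ ∀ (γ : Γ), ∀ x ∈ 𝒜 γ, x ≠ 0 → IsUnit x

/-- A subring `E` of a graded ring is a graded subring if it contains all homogeneous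
components of each of its elements. -/
def IsGradedSubring (𝒜 : Γ → AddSubgroup D) [GradedRing 𝒜] (E : Subring D) : Prop :=
  ∀ x ∈ E, ∀ γ : Γ, (DirectSum.decompose 𝒜 x γ : D) ∈ E

/-- A graded subring which is itself a graded division ring (nonzero homogeneous elements
of `E` are invertible in `E`). -/
def IsGradedDivSubring (𝒜 : Γ → AddSubgroup D) [GradedRing 𝒜] (E : Subring D) : Prop :=
  IsGradedSubring 𝒜 E ∧
    ∀ (γ : Γ), ∀ x ∈ E, x ∈ 𝒜 γ → x ≠ 0 → ∃ y ∈ E, x * y = 1 ∧ y * x = 1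

/-- A graded subfield: a commutative graded division subring. -/
def IsGradedSubfield (𝒜 : Γ → AddSubgroup D) [GradedRing 𝒜] (K : Subring D) : Prop :=
  IsGradedDivSubring 𝒜 K ∧ ∀ x ∈ K, ∀ y ∈ K, x * y = y * x

/-- The grade set `Γ_E` of a subring `E`: the degrees in which `E` has nonzero
homogeneous elements. -/
def gradeSet (𝒜 : Γ → AddSubgroup D) (E : Subring D) : Set Γ :=
  {γ : Γ | ∃ x : D, x ∈ E ∧ x ∈ 𝒜 γ ∧ x ≠ 0}

/-- The index `|A : B|` of subsets of `Γ`: the number of classes of `A` modulo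
translation by `B`. -/
def addSetIndex (A B : Set Γ) : ℕ :=
  Nat.card (Quot (fun x y : A => (x : Γ) - (y : Γ) ∈ B))

/-- `[R : S]`: the rank of the ring `R` as a module over a subring `S`. -/
def dimOver {R : Type*} [Ring R] (S : Subring R) : ℕ := Module.finrank S R

/-- `R` has finite rank over the subring `S`. -/
def finiteOver {R : Type*} [Ring R] (S : Subring R) : Prop := Module.Finite S R

/-- `[A : B]`: the rank of a subring `A` of `R` over a subring `B` (i.e. over `B ∩ A`). -/
def relDim {R : Type*} [Ring R] (B A : Subring R) : ℕ :=
  Module.finrank (B.comap A.subtype) A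

/-- The degree-0 component of a graded ring, as a subring. -/
def grade0 (𝒜 : Γ → AddSubgroup D) [GradedRing 𝒜] : Subring D where
  carrier := 𝒜 0
  zero_mem' := (𝒜 0).zero_mem
  add_mem' := fun ha hb => (𝒜 0).add_mem ha hb
  neg_mem' := fun ha => (𝒜 0).neg_mem ha
  one_mem' := SetLike.one_mem_graded 𝒜
  mul_mem' := fun ha hb => by simpa using SetLike.mul_mem_graded ha hb

/-- `L/F` is a Galois extension (inside an ambient ring `R`): `F ≤ L` and `F` is exactly
the fixed ring of the group of ring automorphisms of `L` fixing `F` pointwise. -/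
def IsGaloisExt {R : Type*} [Ring R] (F L : Subring R) : Prop :=
  F ≤ L ∧ ∀ x : L,
    (∀ σ : L ≃+* L, (∀ y : L, (y : R) ∈ F → σ y = y) → σ x = x) → (x : R) ∈ F

/-- `p` is the minimal polynomial of `c` over the subring `F`: the monic polynomial with
coefficients in `F` annihilating `c` of least degree. -/
def IsMinPolyOf {R : Type*} [Ring R] (F : Subring R) (c : R) (p : Polynomial F) : Prop :=
  p.Monic ∧ Polynomial.eval₂ F.subtype c p = 0 ∧
    ∀ q : Polynomial F, q.Monic → Polynomial.eval₂ F.subtype c q = 0 → p.degree ≤ q.degree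

/-- The polynomial `p` over `F` splits into linear factors over `L`. -/
def SplitsIn {R : Type*} [Ring R] {F L : Subring R} (h : F ≤ L) (p : Polynomial F) : Prop :=
  ∃ s : List L,
    p.map (Subring.inclusion h) = (s.map fun a => Polynomial.X - Polynomial.C a).prod

/-- Normality for an extension of graded subfields: the minimal polynomial over `F` of
every homogeneous element of `L` splits over `L`. -/
def IsNormalExtGr (𝒜 : Γ → AddSubgroup D) [GradedRing 𝒜] (F L : Subring D) : Prop :=
  ∃ h : F ≤ L, ∀ c ∈ L, (∃ γ : Γ, c ∈ 𝒜 γ) →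
    ∀ p : Polynomial F, IsMinPolyOf F c p → SplitsIn h p

/-- Normality for an (ungraded) extension of subfields: the minimal polynomial over `F`
of every element of `L` splits over `L`. -/
def IsNormalExt {R : Type*} [Ring R] (F L : Subring R) : Prop :=
  ∃ h : F ≤ L, ∀ c ∈ L, ∀ p : Polynomial F, IsMinPolyOf F c p → SplitsIn h p

/-- `K` is a (commutative) subfield of the subring `A`. -/
def IsSubfieldOf {R : Type*} [Ring R] (A K : Subring R) : Prop :=
  K ≤ A ∧ (∀ x ∈ K, ∀ y ∈ K, x * y = y * x) ∧
    ∀ x ∈ K, x ≠ 0 → ∃ y ∈ K, x * y = 1 ∧ y * x = 1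

/-- `K` is a maximal subfield of the subring `A`. -/
def IsMaxSubfieldOf {R : Type*} [Ring R] (A K : Subring R) : Prop :=
  IsSubfieldOf A K ∧ ∀ K' : Subring R, IsSubfieldOf A K' → K ≤ K' → K' = K

/-- `T` is a maximal graded subfield of the graded subring `A`. -/
def IsMaxGradedSubfieldOf (𝒜 : Γ → AddSubgroup D) [GradedRing 𝒜] (A T : Subring D) : Prop :=
  IsGradedSubfield 𝒜 T ∧ T ≤ A ∧
    ∀ T' : Subring D, IsGradedSubfield 𝒜 T' → T' ≤ A → T ≤ T' → T' = T

/-- The canonical subalgebra `𝖴 = 𝖣₀ ⊗_{𝖥₀} 𝖥`: the subring generated by `𝖣₀` and `𝖥`. -/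
def Uc (𝒜 : Γ → AddSubgroup D) [GradedRing 𝒜] (F : Subring D) : Subring D :=
  grade0 𝒜 ⊔ F

/-- The canonical subalgebra `𝖹 = Z(𝖣₀) ⊗_{𝖥₀} 𝖥`: the subring generated by the center
of `𝖣₀` and `𝖥`. -/
def Zc (𝒜 : Γ → AddSubgroup D) [GradedRing 𝒜] (F : Subring D) : Subring D :=
  (Subring.centralizer (grade0 𝒜 : Set D) ⊓ grade0 𝒜) ⊔ F

/-- The canonical subalgebra `𝖢 = C_𝖣(𝖴)`. -/
def Cc (𝒜 : Γ → AddSubgroup D) [GradedRing 𝒜] (F : Subring D) : Subring D :=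
  Subring.centralizer (Uc 𝒜 F : Set D)

/-- The canonical subalgebra `𝖤 = C_𝖣(𝖹)`. -/
def Ec (𝒜 : Γ → AddSubgroup D) [GradedRing 𝒜] (F : Subring D) : Subring D :=
  Subring.centralizer (Zc 𝒜 F : Set D)

end GradedDivPaper

namespace GradedDivPaper

/-- A two-sided inverse of a homogeneous element of degree `γ` is homogeneous of
degree `-γ`. -/
theorem mem_neg_of_mul_eq_one {Γ : Type*} [AddCommGroup Γ] [DecidableEq Γ] {D : Type*} [Ring D]
    (𝒜 : Γ → AddSubgroup D) [GradedRing 𝒜] {γ : Γ} {x y : D} (hx : x ∈ 𝒜 γ)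
    (hxy : x * y = 1) (hyx : y * x = 1) : y ∈ 𝒜 (-γ) := by
  have h : x * (DirectSum.decompose 𝒜 y (-γ) : D) = 1 := by
    rw [← DirectSum.coe_decompose_mul_add_of_left_mem 𝒜 hx, hxy, add_neg_cancel,
      DirectSum.decompose_of_mem_same 𝒜 (SetLike.one_mem_graded 𝒜)]
  rw [left_inv_eq_right_inv hyx h]
  exact SetLike.coe_mem _

/-- if `D` is totally ramified over `B`, then
`Γ_{A ⊓ B} = Γ_A ∩ Γ_B` for any graded division subring `A`. -/
theorem stmt_3 {Γ : Type*} [AddCommGroup Γ] [DecidableEq Γ] {D : Type*} [Ring D]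
    (hΓ : TorsionFree Γ) (𝒜 : Γ → AddSubgroup D) [GradedRing 𝒜]
    (hD : IsGradedDivisionRing 𝒜)
    (A B : Subring D) (hA : IsGradedDivSubring 𝒜 A) (hB : IsGradedDivSubring 𝒜 B)
    (htotram : grade0 𝒜 ≤ B) :
    gradeSet 𝒜 (A ⊓ B) = gradeSet 𝒜 A ∩ gradeSet 𝒜 B := by
  ext γ
  constructor
  · rintro ⟨x, hx, hxγ, hx0⟩
    exact ⟨⟨x, hx.1, hxγ, hx0⟩, ⟨x, hx.2, hxγ, hx0⟩⟩
  · rintro ⟨⟨a, haA, haγ, ha0⟩, ⟨b, hbB, hbγ, hb0⟩⟩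
    obtain ⟨y, -, hby, hyb⟩ := hB.2 γ b hbB hbγ hb0
    have hay : a * y ∈ 𝒜 0 := by
      simpa using SetLike.mul_mem_graded haγ (mem_neg_of_mul_eq_one 𝒜 hbγ hby hyb)
    have haB : a * y * b ∈ B := B.mul_mem (htotram hay) hbB
    rw [mul_assoc, hyb, mul_one] at haB
    exact ⟨a, ⟨haA, haB⟩, haγ, ha0⟩

end GradedDivPaper
end
end

section
/- Let \(\mathsf{L}/\mathsf{F}\) be a finite extension of \(\Gamma\)-graded fields. If \(\mathsf{L}/\mathsf{F}\) is normal then the field extension \(\mathsf{L}_0/\mathsf{F}_0\) of degree-0 components is normal, and if \(\mathsf{L}/\mathsf{F}\) is Galois then \(\mathsf{L}_0/\mathsf{F}_0\) is Galois. -/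
noncomputable section

namespace GradedDivPaper

/-- A torsion-free abelian group embeds into a linearly ordered abelian group. -/
theorem TorsionFree.exists_injective_addMonoidHom.{u} {Γ : Type u} [AddCommGroup Γ]
    (hΓ : TorsionFree Γ) :
    ∃ (ι : Type u) (_ : LinearOrder ι) (f : Γ →+ Lex (ι →₀ ℚ)), Function.Injective f := by
  have hinj : Function.Injective (TensorProduct.mk ℤ ℚ Γ 1) := by
    rw [IsLocalizedModule.injective_iff_isRegular (nonZeroDivisors ℤ)]
    intro c x y hxy
    have hc : (c : ℤ) ≠ 0 := nonZeroDivisors.ne_zero c.2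
    have h0 : (c : ℤ) • (x - y) = 0 := by
      rw [smul_sub, sub_eq_zero]
      exact hxy
    refine sub_eq_zero.1 (hΓ _ (c : ℤ).natAbs (Int.natAbs_ne_zero.2 hc) ?_)
    rcases Int.natAbs_eq (c : ℤ) with h | h
    · rw [h, natCast_zsmul] at h0
      exact h0
    · rw [h, neg_smul, natCast_zsmul, neg_eq_zero] at h0
      exact h0
  let b := Module.Basis.ofVectorSpace ℚ (TensorProduct ℤ ℚ Γ)
  refine ⟨Module.Basis.ofVectorSpaceIndex ℚ (TensorProduct ℤ ℚ Γ),
    IsWellOrder.linearOrder WellOrderingRel,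
    { toFun := fun γ => toLex (b.repr (TensorProduct.mk ℤ ℚ Γ 1 γ))
      map_zero' := by simp
      map_add' := fun x y => by rw [map_add, map_add]; rfl }, ?_⟩
  intro x y hxy
  exact hinj (b.repr.injective (toLex.injective hxy))

section Leading

variable {Γ : Type*} [AddCommGroup Γ] [DecidableEq Γ] {L : Type*} [CommRing L]
  (𝒜 : Γ → AddSubgroup L) [GradedRing 𝒜]
  {O : Type*} [AddCommGroup O] [LinearOrder O] (f : Γ →+ O)

/-- All homogeneous components of `x` have `f`-degree at most `δ`. -/
def DegLE (δ : O) (x : L) : Prop :=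
  ∀ γ : Γ, δ < f γ → (DirectSum.decompose 𝒜 x γ : L) = 0

variable {𝒜 f}

theorem degLE_one : DegLE 𝒜 f 0 (1 : L) := by
  intro γ hγ
  refine DirectSum.decompose_of_mem_ne 𝒜 (SetLike.one_mem_graded 𝒜) ?_
  rintro rfl
  simp at hγ

variable [IsOrderedAddMonoid O]

theorem DegLE.mul {δ ε : O} {x y : L} (hx : DegLE 𝒜 f δ x) (hy : DegLE 𝒜 f ε y) :
    DegLE 𝒜 f (δ + ε) (x * y) := by
  classical
  intro γ hγ
  rw [DirectSum.decompose_mul, DirectSum.coe_mul_apply]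
  refine Finset.sum_eq_zero fun ij hij => ?_
  have hsum : ij.1 + ij.2 = γ := (Finset.mem_filter.1 hij).2
  rw [← hsum, map_add] at hγ
  rcases lt_or_lt_of_add_lt_add hγ with h | h
  · rw [hx _ h, zero_mul]
  · rw [hy _ h, mul_zero]

theorem DegLE.decompose_mul (hf : Function.Injective f) {γ γ' : Γ} {x y : L}
    (hx : DegLE 𝒜 f (f γ) x) (hy : DegLE 𝒜 f (f γ') y) :
    (DirectSum.decompose 𝒜 (x * y) (γ + γ') : L) =
      DirectSum.decompose 𝒜 x γ * DirectSum.decompose 𝒜 y γ' := by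
  classical
  rw [DirectSum.decompose_mul, DirectSum.coe_mul_apply, Finset.sum_filter]
  have key : ∀ i j : Γ, i + j = γ + γ' → (i, j) ≠ (γ, γ') →
      (DirectSum.decompose 𝒜 x i * DirectSum.decompose 𝒜 y j : L) = 0 := by
    intro i j hij hne
    rcases lt_trichotomy (f γ) (f i) with h | h | h
    · rw [hx _ h, zero_mul]
    · obtain rfl := hf h
      exact absurd (by rw [add_left_cancel hij]) hne
    · have h' : f γ' < f j := by
        have hs : f i + f j = f γ + f γ' := by rw [← map_add, hij, map_add]
        by_contra hle
        exact (add_lt_add_of_lt_of_le h (not_lt.1 hle)).ne hs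
      rw [hy _ h', mul_zero]
  rw [Finset.sum_eq_single (γ, γ')]
  · simp
  · rintro ⟨i, j⟩ - hne
    dsimp only
    split_ifs with h
    · exact key i j h hne
    · rfl
  · intro h
    rw [Finset.mem_product, not_and_or, DFinsupp.notMem_support_iff,
      DFinsupp.notMem_support_iff] at h
    rcases h with h | h <;> simp [h]

theorem DegLE.pow {δ : O} {x : L} (hx : DegLE 𝒜 f δ x) (n : ℕ) :
    DegLE 𝒜 f (n • δ) (x ^ n) := by
  induction n with
  | zero => simpa using degLE_one
  | succ n ih =>
    rw [pow_succ, succ_nsmul]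
    exact ih.mul hx

theorem DegLE.decompose_pow (hf : Function.Injective f) {γ : Γ} {x : L}
    (hx : DegLE 𝒜 f (f γ) x) (n : ℕ) :
    (DirectSum.decompose 𝒜 (x ^ n) (n • γ) : L) = (DirectSum.decompose 𝒜 x γ : L) ^ n := by
  induction n with
  | zero =>
    rw [pow_zero, pow_zero, zero_nsmul]
    exact DirectSum.decompose_of_mem_same 𝒜 (SetLike.one_mem_graded 𝒜)
  | succ n ih =>
    rw [pow_succ, succ_nsmul, pow_succ, ← ih]
    refine DegLE.decompose_mul hf ?_ hx
    rw [map_nsmul]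
    exact hx.pow n

/-- The components of a polynomial expression with coefficients of degree `0`. -/
theorem decompose_eval {p : Polynomial L} (hp : ∀ i, p.coeff i ∈ 𝒜 0) (x : L) (γ : Γ) :
    (DirectSum.decompose 𝒜 (p.eval x) γ : L) =
      ∑ i ∈ Finset.range (p.natDegree + 1),
        p.coeff i * (DirectSum.decompose 𝒜 (x ^ i) γ : L) := by
  rw [Polynomial.eval_eq_sum_range, DirectSum.decompose_sum, DFinsupp.finsetSum_apply,
    AddSubmonoidClass.coe_finsetSum]
  exact Finset.sum_congr rfl fun i _ =>
    DirectSum.coe_decompose_mul_of_left_mem_zero 𝒜 (hp i)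

/-- An element integral over the degree `0` part has no components of positive degree. -/
theorem not_pos_of_eval_eq_zero (hL : IsGradedDivisionRing 𝒜) (hf : Function.Injective f)
    {p : Polynomial L} (hmonic : p.Monic) (hp : ∀ i, p.coeff i ∈ 𝒜 0) {x : L}
    (hx : p.eval x = 0) {γ : Γ} (hγ : (DirectSum.decompose 𝒜 x γ : L) ≠ 0) : f γ ≤ 0 := by
  classical
  have hmem : ∀ β, β ∈ (DirectSum.decompose 𝒜 x).support ↔
      (DirectSum.decompose 𝒜 x β : L) ≠ 0 := fun β => by simp
  obtain ⟨β, hβ, hmax⟩ := (DirectSum.decompose 𝒜 x).support.exists_max_image f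
    ⟨γ, (hmem γ).2 hγ⟩
  refine (hmax γ ((hmem γ).2 hγ)).trans (not_lt.1 fun hpos => ?_)
  have hle : DegLE 𝒜 f (f β) x := fun α hα => by
    by_contra h
    exact (hmax α ((hmem α).2 h)).not_gt hα
  have h0 := decompose_eval hp x (p.natDegree • β)
  rw [hx, Finset.sum_range_succ, Finset.sum_eq_zero, zero_add, hmonic.coeff_natDegree, one_mul,
    hle.decompose_pow hf] at h0
  · have : Nontrivial L := ⟨⟨0, 1, hL.1⟩⟩
    have hu := (hL.2 β _ (DirectSum.decompose 𝒜 x β).2 ((hmem β).1 hβ)).pow p.natDegree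
    refine hu.ne_zero (h0.symm.trans ?_)
    simp
  · intro i hi
    rw [hle.pow i, mul_zero]
    rw [map_nsmul]
    exact nsmul_lt_nsmul_left hpos (Finset.mem_range.1 hi)

end Leading

section Residue

variable {Γ : Type*} [AddCommGroup Γ] [DecidableEq Γ] {L : Type*} [CommRing L]
  {𝒜 : Γ → AddSubgroup L} [GradedRing 𝒜]

/-- The degree `0` part of a graded field is integrally closed. -/
theorem mem_zero_of_eval_eq_zero (hΓ : TorsionFree Γ) (hL : IsGradedDivisionRing 𝒜)
    {p : Polynomial L} (hmonic : p.Monic) (hp : ∀ i, p.coeff i ∈ 𝒜 0) {x : L}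
    (hx : p.eval x = 0) : x ∈ 𝒜 0 := by
  classical
  obtain ⟨ι, _, f, hf⟩ := hΓ.exists_injective_addMonoidHom
  have hneg : Function.Injective (-f) := fun a b h => hf (neg_injective h)
  rw [← DirectSum.sum_support_decompose 𝒜 x]
  refine sum_mem fun γ hγ => ?_
  have hγ' : (DirectSum.decompose 𝒜 x γ : L) ≠ 0 := by simpa using hγ
  have h1 := not_pos_of_eval_eq_zero hL hf hmonic hp hx hγ'
  have h2 := not_pos_of_eval_eq_zero hL hneg hmonic hp hx hγ'
  rw [AddMonoidHom.neg_apply, neg_nonpos] at h2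
  have h3 : γ = 0 := hf (by rw [map_zero]; exact le_antisymm h1 h2)
  rw [h3]
  exact (DirectSum.decompose 𝒜 x 0).2

theorem mem_grade0_of_eval₂_eq_zero (hΓ : TorsionFree Γ) (hL : IsGradedDivisionRing 𝒜)
    {F : Subring L} {p : Polynomial (F ⊓ grade0 𝒜 : Subring L)} (hp : p.Monic) {x : L}
    (hx : p.eval₂ (F ⊓ grade0 𝒜).subtype x = 0) : x ∈ grade0 𝒜 := by
  refine mem_zero_of_eval_eq_zero hΓ hL (hp.map (F ⊓ grade0 𝒜).subtype) (fun i => ?_)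
    ((Polynomial.eval_map _ _).trans hx)
  rw [Polynomial.coeff_map]
  exact (p.coeff i).2.2

/-- A monic relation over `F` for an element of degree `0` yields one of the same degree over the
degree `0` part of `F`. -/
theorem exists_monic_over_grade0 (hL : IsGradedDivisionRing 𝒜) {F : Subring L}
    (hF : IsGradedSubring 𝒜 F) {c : L} (hc : c ∈ grade0 𝒜) {q : Polynomial F} (hq : q.Monic)
    (hqc : q.eval₂ F.subtype c = 0) :
    ∃ r : Polynomial (F ⊓ grade0 𝒜 : Subring L),
      r.Monic ∧ r.eval₂ (F ⊓ grade0 𝒜).subtype c = 0 ∧ r.degree = q.degree := by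
  have : Nontrivial L := ⟨⟨0, 1, hL.1⟩⟩
  let a : ℕ → (F ⊓ grade0 𝒜 : Subring L) := fun i =>
    ⟨DirectSum.decompose 𝒜 (q.coeff i : L) 0,
      hF _ (q.coeff i).2 0, (DirectSum.decompose 𝒜 (q.coeff i : L) 0).2⟩
  have hdeg := Polynomial.degree_sum_fin_lt fun i : Fin q.natDegree => a i
  refine ⟨_, Polynomial.monic_X_pow_add hdeg, ?_, ?_⟩
  · have hcp : ∀ i, c ^ i ∈ 𝒜 0 := fun i => (grade0 𝒜).pow_mem hc i
    have h := congrArg (GradedRing.proj 𝒜 0) hqc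
    rw [Polynomial.eval₂_eq_sum_range, Finset.sum_range_succ, hq.coeff_natDegree, map_one,
      one_mul, map_add, map_sum, map_zero] at h
    simp only [GradedRing.proj_apply, DirectSum.decompose_of_mem_same 𝒜 (hcp _),
      DirectSum.coe_decompose_mul_of_right_mem_zero 𝒜 (hcp _)] at h
    rw [Polynomial.eval₂_add, Polynomial.eval₂_X_pow, Polynomial.eval₂_finsetSum]
    simp only [Polynomial.eval₂_mul, Polynomial.eval₂_C, Polynomial.eval₂_X_pow]
    rw [Fin.sum_univ_eq_sum_range (fun i => (F ⊓ grade0 𝒜).subtype (a i) * c ^ i), add_comm]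
    exact h
  · rw [Polynomial.degree_add_eq_left_of_degree_lt (by rwa [Polynomial.degree_X_pow]),
      Polynomial.degree_X_pow, Polynomial.degree_eq_natDegree hq.ne_zero]

theorem IsMinPolyOf.map_inclusion (hL : IsGradedDivisionRing 𝒜) {F : Subring L}
    (hF : IsGradedSubring 𝒜 F) {c : L} (hc : c ∈ grade0 𝒜)
    {p : Polynomial (F ⊓ grade0 𝒜 : Subring L)} (hp : IsMinPolyOf (F ⊓ grade0 𝒜) c p) :
    IsMinPolyOf F c (p.map (Subring.inclusion inf_le_left)) := by
  refine ⟨hp.1.map _, ?_, fun q hq hqc => ?_⟩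
  · rw [Polynomial.eval₂_map]
    exact hp.2.1
  · obtain ⟨r, hr, hrc, hdeg⟩ := exists_monic_over_grade0 hL hF hc hq hqc
    exact Polynomial.degree_map_le.trans (hdeg ▸ hp.2.2 r hr hrc)

theorem IsNormalExtGr.isNormalExt_grade0 (hΓ : TorsionFree Γ) (hL : IsGradedDivisionRing 𝒜)
    {F : Subring L} (hF : IsGradedSubring 𝒜 F) (h : IsNormalExtGr 𝒜 F ⊤) :
    IsNormalExt (F ⊓ grade0 𝒜) (grade0 𝒜) := by
  obtain ⟨hle, h⟩ := h
  refine ⟨inf_le_right, fun c hc p hp => ?_⟩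
  obtain ⟨s, hs⟩ := h c trivial ⟨0, hc⟩ _ (hp.map_inclusion hL hF hc)
  have hs' : p.map (F ⊓ grade0 𝒜).subtype =
      ((s.map (⊤ : Subring L).subtype).map fun a => Polynomial.X - Polynomial.C a).prod := by
    have := congrArg (Polynomial.mapRingHom (⊤ : Subring L).subtype) hs
    rw [map_list_prod, List.map_map] at this
    simp only [Polynomial.coe_mapRingHom, Polynomial.map_map] at this
    refine Eq.trans ?_ (this.trans ?_)
    · rfl
    · rw [List.map_map]
      congr 2
      funext a
      simp
  have hmem : ∀ a ∈ s.map (⊤ : Subring L).subtype, a ∈ grade0 𝒜 := by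
    intro a ha
    refine mem_grade0_of_eval₂_eq_zero hΓ hL hp.1 ?_
    rw [← Polynomial.eval_map, hs', Polynomial.eval_list_prod]
    refine List.prod_eq_zero (List.mem_map.2 ⟨Polynomial.X - Polynomial.C a,
      List.mem_map.2 ⟨a, ha, rfl⟩, by simp⟩)
  generalize s.map (⊤ : Subring L).subtype = t at hs' hmem
  lift t to List (grade0 𝒜) using hmem
  refine ⟨t, Polynomial.map_injective (grade0 𝒜).subtype Subtype.val_injective ?_⟩
  rw [Polynomial.map_map, ← Polynomial.coe_mapRingHom, ← Polynomial.coe_mapRingHom,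
    map_list_prod, List.map_map]
  refine Eq.trans hs' ?_
  rw [List.map_map]
  congr 2
  funext a
  simp

theorem IsGaloisExt.isGaloisExt_grade0 (hΓ : TorsionFree Γ) (hL : IsGradedDivisionRing 𝒜)
    {F : Subring L} (hF : IsGradedSubring 𝒜 F) (hfin : finiteOver F)
    (h : IsGaloisExt F (⊤ : Subring L)) : IsGaloisExt (F ⊓ grade0 𝒜) (grade0 𝒜) := by
  refine ⟨inf_le_right, fun x hx => ⟨h.2 ⟨x, trivial⟩ fun σ hσ => ?_, x.2⟩⟩
  have : Module.Finite F L := hfin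
  have hmem : ∀ τ : (⊤ : Subring L) ≃+* (⊤ : Subring L),
      (∀ y : (⊤ : Subring L), (y : L) ∈ F → τ y = y) →
      ∀ y : (⊤ : Subring L), (y : L) ∈ grade0 𝒜 → (τ y : L) ∈ grade0 𝒜 := by
    intro τ hτ y hy
    obtain ⟨q, hq, hqy⟩ := Algebra.IsIntegral.isIntegral (R := F) (y : L)
    obtain ⟨r, hr, hry, -⟩ := exists_monic_over_grade0 hL hF hy hq hqy
    refine mem_grade0_of_eval₂_eq_zero hΓ hL hr ?_
    let g : (⊤ : Subring L) →+* L := (⊤ : Subring L).subtype.comp τ.toRingHom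
    have hg : g.comp (Subring.inclusion (le_top : F ⊓ grade0 𝒜 ≤ ⊤)) =
        (F ⊓ grade0 𝒜).subtype := by
      ext z
      exact congrArg Subtype.val (hτ ⟨z, trivial⟩ z.2.1)
    have hy0 : r.eval₂ (Subring.inclusion (le_top : F ⊓ grade0 𝒜 ≤ ⊤)) y = 0 := by
      refine Subtype.val_injective ?_
      refine (Polynomial.hom_eval₂ r _ (⊤ : Subring L).subtype y).trans ?_
      exact hry
    have := Polynomial.hom_eval₂ r (Subring.inclusion (le_top : F ⊓ grade0 𝒜 ≤ ⊤)) g y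
    rw [hy0, map_zero, hg] at this
    exact this.symm
  have hσ' : ∀ y : (⊤ : Subring L), (y : L) ∈ F → σ.symm y = y := fun y hy => by
    rw [RingEquiv.symm_apply_eq, hσ y hy]
  have hval : ∀ {a b : (⊤ : Subring L)}, a = b → (a : L) = b := congrArg _
  let ι : grade0 𝒜 → (⊤ : Subring L) := fun y => ⟨y, trivial⟩
  let σ₀ : grade0 𝒜 ≃+* grade0 𝒜 :=
    { toFun := fun y => ⟨σ (ι y), hmem σ hσ _ y.2⟩
      invFun := fun y => ⟨σ.symm (ι y), hmem σ.symm hσ' _ y.2⟩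
      left_inv := fun y => Subtype.ext (hval (σ.symm_apply_apply (ι y)))
      right_inv := fun y => Subtype.ext (hval (σ.apply_symm_apply (ι y)))
      map_mul' := fun y z => Subtype.ext (hval (map_mul σ (ι y) (ι z)))
      map_add' := fun y z => Subtype.ext (hval (map_add σ (ι y) (ι z))) }
  have hfix : σ₀ x = x := hx σ₀ fun y hy => Subtype.ext (hval (hσ (ι y) hy.1))
  have hfix' : (σ₀ x : L) = x := congrArg _ hfix
  exact Subtype.ext hfix'

end Residue


/-- for a finite extension of graded fields `L/F`, normality
(resp. Galois-ness) passes to the residue extension `L₀/F₀`. -/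
theorem stmt_6 {Γ : Type*} [AddCommGroup Γ] [DecidableEq Γ] {L : Type*} [CommRing L]
    (hΓ : TorsionFree Γ) (𝒜 : Γ → AddSubgroup L) [GradedRing 𝒜]
    (hL : IsGradedDivisionRing 𝒜)
    (F : Subring L) (hF : IsGradedSubfield 𝒜 F) (hfin : finiteOver F) :
    (IsNormalExtGr 𝒜 F ⊤ → IsNormalExt (F ⊓ grade0 𝒜) (grade0 𝒜)) ∧
      (IsGaloisExt F (⊤ : Subring L) → IsGaloisExt (F ⊓ grade0 𝒜) (grade0 𝒜)) :=
  ⟨fun h => h.isNormalExt_grade0 hΓ hL hF.1.1,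
    fun h => h.isGaloisExt_grade0 hΓ hL hF.1.1 hfin⟩

end GradedDivPaper
end
end

section
/- Let \(\mathsf{D}\) be a finite-dimensional graded division algebra with center \(\mathsf{F}\), with canonical subalgebras \(\mathsf{U}=\mathsf{D}_0\otimes_{\mathsf{F}_0}\mathsf{F}\), \(\mathsf{Z}=Z(\mathsf{D}_0)\otimes_{\mathsf{F}_0}\mathsf{F}\), \(\mathsf{C}=C_{\mathsf{D}}(\mathsf{U})\), and \(\mathsf{E}=C_{\mathsf{D}}(\mathsf{Z})\). Then for every maximal graded subfield \(\mathsf{T}\) of \(\mathsf{C}\), the grade group of the centralizer \(C_{\mathsf{E}}(\mathsf{T})\) equals the grade group \(\Gamma_{\mathsf{T}}\) of \(\mathsf{T}\). -/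
noncomputable section

namespace GradedDivPaper

section SkolemNoether

/-- If the `b i` are linearly independent over the center, the right multiplications by the
`b i` are left linearly independent. -/
lemma eq_zero_of_sum_mul_mul_eq_zero {K : Type*} [DivisionRing K] {ι : Type*} {b : ι → K}
    (hb : LinearIndependent (Subring.center K) b) (s : Finset ι) :
    ∀ a : ι → K, (∀ y, ∑ i ∈ s, a i * y * b i = 0) → ∀ i ∈ s, a i = 0 := by
  classical
  induction s using Finset.induction_on with
  | empty => simp
  | insert j s hj ih =>
    intro a ha
    by_cases haj : a j = 0
    · have hs := ih a (fun y => by simpa [Finset.sum_insert hj, haj] using ha y)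
      intro i hi
      rcases Finset.mem_insert.1 hi with rfl | hi
      exacts [haj, hs i hi]
    exfalso
    have hnorm : ∀ y, ∑ i ∈ insert j s, ((a j)⁻¹ * a i) * y * b i = 0 := by
      intro y
      have h := congrArg ((a j)⁻¹ * ·) (ha y)
      simpa [Finset.mul_sum, mul_assoc] using h
    have hcomm : ∀ c, ∀ i ∈ s, (a j)⁻¹ * a i * c - c * ((a j)⁻¹ * a i) = 0 := by
      intro c
      apply ih
      intro y
      have h1 := hnorm (c * y)
      have h2 := congrArg (c * ·) (hnorm y)
      simp only [Finset.mul_sum, mul_zero] at h2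
      have h3 : ∑ i ∈ insert j s, ((a j)⁻¹ * a i * c - c * ((a j)⁻¹ * a i)) * y * b i = 0 := by
        rw [← sub_zero (0 : K)]
        nth_rewrite 1 [← h1]
        rw [← h2, ← Finset.sum_sub_distrib]
        exact Finset.sum_congr rfl fun i _ => by noncomm_ring
      rw [Finset.sum_insert hj] at h3
      simpa [inv_mul_cancel₀ haj] using h3
    have hcen : ∀ i ∈ insert j s, (a j)⁻¹ * a i ∈ Subring.center K := by
      intro i hi
      rw [Subring.mem_center_iff]
      intro c
      rcases Finset.mem_insert.1 hi with rfl | hi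
      · simp [inv_mul_cancel₀ haj]
      · exact (sub_eq_zero.1 (hcomm c i hi)).symm
    let z : ι → Subring.center K := fun i =>
      if hi : i ∈ insert j s then ⟨(a j)⁻¹ * a i, hcen i hi⟩ else 0
    have hz := linearIndependent_iff'.1 hb (insert j s) z (by
      rw [← hnorm 1]
      refine Finset.sum_congr rfl fun i hi => ?_
      simp only [z, dif_pos hi, Subring.smul_def, smul_eq_mul, mul_one]) j
      (Finset.mem_insert_self j s)
    have hz' := congrArg Subtype.val hz
    simp [z, inv_mul_cancel₀ haj] at hz'

/-- Skolem-Noether for a division ring finite-dimensional over its center: an endomorphism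
which is the identity on the center is inner. -/
lemma exists_ne_zero_forall_map_mul_eq {K : Type*} [DivisionRing K]
    [Module.Finite (Subring.center K) K] (σ : K →+* K)
    (hσ : ∀ z ∈ Subring.center K, σ z = z) :
    ∃ d : K, d ≠ 0 ∧ ∀ a, σ a * d = d * a := by
  let b := Module.finBasis (Subring.center K) K
  let R : Fin (Module.finrank (Subring.center K) K) → (K →ₗ[Subring.center K] K) :=
    fun i => LinearMap.mulRight (Subring.center K) (b i)
  have hR : LinearIndependent K R := by
    rw [linearIndependent_iff']
    intro s a ha
    apply eq_zero_of_sum_mul_mul_eq_zero b.linearIndependent s a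
    intro y
    have h := LinearMap.congr_fun ha y
    simpa [R, mul_assoc] using h
  have : Nonempty (Fin (Module.finrank (Subring.center K) K)) :=
    ⟨⟨0, Module.finrank_pos⟩⟩
  have hspan := hR.span_eq_top_of_card_eq_finrank (by
    rw [Fintype.card_fin, Module.finrank_linearMap_self])
  let σ' : K →ₗ[Subring.center K] K :=
    { toFun := σ
      map_add' := map_add σ
      map_smul' := fun z x => by
        simp [Subring.smul_def, hσ z z.2] }
  have hmem : σ' ∈ Submodule.span K (Set.range R) := hspan ▸ Submodule.mem_top
  obtain ⟨a, ha⟩ := (Submodule.mem_span_range_iff_exists_fun K).1 hmem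
  have hval : ∀ y, ∑ i, a i * y * b i = σ y := fun y => by
    have h := LinearMap.congr_fun ha y
    simpa [R, σ', mul_assoc] using h
  have hint : ∀ c i, a i * c - σ c * a i = 0 := by
    intro c i
    refine eq_zero_of_sum_mul_mul_eq_zero b.linearIndependent Finset.univ
      (fun i => a i * c - σ c * a i) (fun y => ?_) i (Finset.mem_univ i)
    have h1 := hval (c * y)
    have h2 : ∑ i, σ c * (a i * y * b i) = σ c * σ y := by rw [← Finset.mul_sum, hval]
    rw [map_mul, ← h2, ← sub_eq_zero, ← Finset.sum_sub_distrib] at h1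
    rw [← h1]
    exact Finset.sum_congr rfl fun i _ => by noncomm_ring
  have hne : ∃ i, a i ≠ 0 := by
    by_contra! h
    have h1 := hval 1
    simp [h] at h1
  obtain ⟨i, hi⟩ := hne
  exact ⟨a i, hi, fun c => (sub_eq_zero.1 (hint c i)).symm⟩

end SkolemNoether

section Graded

variable {Γ : Type*} [AddCommGroup Γ] [DecidableEq Γ] {D : Type*} [Ring D]
  (𝒜 : Γ → AddSubgroup D) [GradedRing 𝒜]

/-- The centralizer of a set stable under taking homogeneous components is graded. -/
lemma isGradedSubring_centralizer {S : Set D}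
    (hS : ∀ s ∈ S, ∀ γ : Γ, (DirectSum.decompose 𝒜 s γ : D) ∈ S) :
    IsGradedSubring 𝒜 (Subring.centralizer S) := by
  classical
  intro x hx γ
  rw [Subring.mem_centralizer_iff] at hx ⊢
  intro s hs
  have hcomp : ∀ δ, (DirectSum.decompose 𝒜 s δ : D) * DirectSum.decompose 𝒜 x γ =
      DirectSum.decompose 𝒜 x γ * DirectSum.decompose 𝒜 s δ := by
    intro δ
    have hδ : (DirectSum.decompose 𝒜 s δ : D) ∈ 𝒜 δ := SetLike.coe_mem _
    rw [← DirectSum.coe_decompose_mul_add_of_left_mem 𝒜 hδ,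
      ← DirectSum.coe_decompose_mul_add_of_right_mem 𝒜 hδ, hx _ (hS s hs δ), add_comm δ γ]
  rw [← DirectSum.sum_support_decompose 𝒜 s, Finset.sum_mul, Finset.mul_sum]
  exact Finset.sum_congr rfl fun δ _ => hcomp δ

lemma isGradedSubring_center : IsGradedSubring 𝒜 (Subring.center D) := by
  rw [← Subring.centralizer_univ]
  exact isGradedSubring_centralizer 𝒜 fun _ _ _ => Set.mem_univ _

/-- An inverse of a homogeneous element of degree `γ` is homogeneous of degree `-γ`. -/
lemma inverse_mem {γ : Γ} {x y : D} (hx : x ∈ 𝒜 γ) (hxy : x * y = 1) (hyx : y * x = 1) :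
    y ∈ 𝒜 (-γ) := by
  have h := DirectSum.coe_decompose_mul_add_of_left_mem 𝒜 (j := -γ) (b := y) hx
  rw [hxy, add_neg_cancel, DirectSum.decompose_of_mem_same 𝒜 (SetLike.one_mem_graded 𝒜)] at h
  have h' : y = DirectSum.decompose 𝒜 y (-γ) := by
    calc y = y * (x * DirectSum.decompose 𝒜 y (-γ)) := by rw [← h, mul_one]
      _ = _ := by rw [← mul_assoc, hyx, one_mul]
  rw [h']
  exact SetLike.coe_mem _

variable {𝒜}

lemma IsGradedDivisionRing.exists_inverse (hD : IsGradedDivisionRing 𝒜) {γ : Γ} {x : D}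
    (hx : x ∈ 𝒜 γ) (hx0 : x ≠ 0) : ∃ y ∈ 𝒜 (-γ), x * y = 1 ∧ y * x = 1 := by
  obtain ⟨u, rfl⟩ := hD.2 γ x hx hx0
  exact ⟨_, inverse_mem 𝒜 hx u.mul_inv u.inv_mul, u.mul_inv, u.inv_mul⟩

lemma IsGradedDivisionRing.isUnit_or_eq_zero (hD : IsGradedDivisionRing 𝒜) (a : grade0 𝒜) :
    IsUnit a ∨ a = 0 := by
  by_cases ha : (a : D) = 0
  · exact Or.inr (Subtype.ext ha)
  · obtain ⟨y, hy, h1, h2⟩ := hD.exists_inverse a.2 ha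
    exact Or.inl ⟨⟨a, ⟨y, by rwa [neg_zero] at hy⟩, Subtype.ext h1, Subtype.ext h2⟩, rfl⟩

lemma IsGradedDivisionRing.finite_grade0 (hD : IsGradedDivisionRing 𝒜)
    (hfin : finiteOver (Subring.center D)) :
    Module.Finite (Subring.center (grade0 𝒜)) (grade0 𝒜) := by
  classical
  obtain ⟨S, hS⟩ := hfin.fg_top
  have hu : ∀ γ : Γ, ∃ u ∈ Subring.center D, u ∈ 𝒜 (-γ) ∧
      ∀ v ∈ Subring.center D, v ∈ 𝒜 (-γ) →
        ∃ w ∈ Subring.center D, w ∈ 𝒜 0 ∧ v = w * u := by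
    intro γ
    by_cases h : ∃ u ∈ Subring.center D, u ∈ 𝒜 (-γ) ∧ u ≠ 0
    · obtain ⟨u, huc, hu, hu0⟩ := h
      refine ⟨u, huc, hu, fun v hvc hv => ?_⟩
      obtain ⟨y, hy, h1, h2⟩ := hD.exists_inverse hu hu0
      have hyc : y ∈ Subring.center D := by
        rw [Subring.mem_center_iff] at huc ⊢
        intro g
        calc g * y = y * (u * g) * y := by rw [← mul_assoc, h2, one_mul]
          _ = y * g := by rw [← huc g, mul_assoc, mul_assoc, h1, mul_one]
      refine ⟨v * y, mul_mem hvc hyc, ?_, by rw [mul_assoc, h2, mul_one]⟩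
      simpa using SetLike.mul_mem_graded hv hy
    · push Not at h
      exact ⟨0, zero_mem _, zero_mem _, fun v hvc hv => ⟨0, zero_mem _, zero_mem _, by
        rw [h v hvc hv, mul_zero]⟩⟩
  choose u huc hu hdiv using hu
  let g : D → Γ → grade0 𝒜 := fun s γ =>
    ⟨u γ * DirectSum.decompose 𝒜 s γ, by
      have h := SetLike.mul_mem_graded (hu γ) (SetLike.coe_mem (DirectSum.decompose 𝒜 s γ))
      rwa [neg_add_cancel] at h⟩
  let G : Finset (grade0 𝒜) :=
    S.biUnion fun s => (DirectSum.decompose 𝒜 s).support.image (g s)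
  refine ⟨⟨G, eq_top_iff.2 fun y _ => ?_⟩⟩
  have hproj : ∀ x : D, ∃ t ∈ Submodule.span (Subring.center (grade0 𝒜)) (G : Set (grade0 𝒜)),
      (t : D) = DirectSum.decompose 𝒜 x 0 := by
    intro x
    have hx : x ∈ Submodule.span (Subring.center D) (S : Set D) := hS ▸ Submodule.mem_top
    obtain ⟨c, -, rfl⟩ := Submodule.mem_span_finset.1 hx
    have hw : ∀ s γ, ∃ w ∈ Subring.center D, w ∈ 𝒜 0 ∧
        (DirectSum.decompose 𝒜 (c s : D) (-γ) : D) = w * u γ := fun s γ =>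
      hdiv γ _ (isGradedSubring_center 𝒜 _ (c s).2 _) (SetLike.coe_mem _)
    choose w hwc hw0 hw using hw
    let w' : D → Γ → Subring.center (grade0 𝒜) := fun s γ =>
      ⟨⟨w s γ, hw0 s γ⟩, Subring.mem_center_iff.2 fun a =>
        Subtype.ext (Subring.mem_center_iff.1 (hwc s γ) a)⟩
    refine ⟨∑ s ∈ S, ∑ γ ∈ (DirectSum.decompose 𝒜 s).support, w' s γ • g s γ,
      Submodule.sum_mem _ fun s hs => Submodule.sum_mem _ fun γ hγ =>
        Submodule.smul_mem _ _ (Submodule.subset_span (Finset.mem_coe.2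
          (Finset.mem_biUnion.2 ⟨s, hs, Finset.mem_image_of_mem _ hγ⟩))), ?_⟩
    rw [DirectSum.decompose_sum, DFinsupp.finsetSum_apply, AddSubgroup.val_finsetSum]
    rw [AddSubmonoidClass.coe_finsetSum]
    refine Finset.sum_congr rfl fun s _ => ?_
    rw [AddSubmonoidClass.coe_finsetSum]
    have hs : c s • s = ∑ γ ∈ (DirectSum.decompose 𝒜 s).support,
        (c s : D) * DirectSum.decompose 𝒜 s γ := by
      rw [← Finset.mul_sum, DirectSum.sum_support_decompose]
      rfl
    rw [hs, DirectSum.decompose_sum, DFinsupp.finsetSum_apply, AddSubgroup.val_finsetSum]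
    refine Finset.sum_congr rfl fun γ _ => ?_
    have h := DirectSum.coe_decompose_mul_add_of_right_mem 𝒜 (i := -γ) (a := (c s : D))
      (SetLike.coe_mem (DirectSum.decompose 𝒜 s γ))
    rw [neg_add_cancel] at h
    rw [h, hw, mul_assoc]
    rfl
  obtain ⟨t, ht, hty⟩ := hproj y
  rw [DirectSum.decompose_of_mem_same 𝒜 y.2] at hty
  rwa [← Subtype.ext hty]

/-- A homogeneous unit commuting with the center of the degree-0 component induces on that
component the same automorphism as some nonzero element of degree 0. -/
lemma IsGradedDivisionRing.exists_grade0_conj (hD : IsGradedDivisionRing 𝒜)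
    (hfin : finiteOver (Subring.center D)) {γ : Γ} {x y : D} (hx : x ∈ 𝒜 γ) (hy : y ∈ 𝒜 (-γ))
    (hxy : x * y = 1) (hyx : y * x = 1)
    (hcomm : ∀ z ∈ Subring.centralizer (grade0 𝒜 : Set D) ⊓ grade0 𝒜, z * x = x * z) :
    ∃ d ∈ 𝒜 0, d ≠ 0 ∧ ∀ a ∈ 𝒜 0, x * a * y * d = d * a := by
  have : Nontrivial (grade0 𝒜) := ⟨0, 1, fun h => hD.1 (congrArg Subtype.val h)⟩
  let _ : DivisionRing (grade0 𝒜) := DivisionRing.ofIsUnitOrEqZero hD.isUnit_or_eq_zero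
  have : Module.Finite (Subring.center (grade0 𝒜)) (grade0 𝒜) := hD.finite_grade0 hfin
  let σ : grade0 𝒜 →+* grade0 𝒜 :=
    { toFun := fun a => ⟨x * a * y, by
        have h := SetLike.mul_mem_graded (SetLike.mul_mem_graded hx a.2) hy
        rwa [add_zero, add_neg_cancel] at h⟩
      map_one' := Subtype.ext (by
        change x * 1 * y = 1
        rw [mul_one, hxy])
      map_zero' := Subtype.ext (by
        change x * 0 * y = 0
        rw [mul_zero, zero_mul])
      map_add' := fun a b => Subtype.ext (by
        change x * (a + b : D) * y = x * a * y + x * b * y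
        rw [mul_add, add_mul])
      map_mul' := fun a b => Subtype.ext (by
        change x * (a * b : D) * y = x * a * y * (x * b * y)
        calc x * (a * b : D) * y = x * a * 1 * b * y := by noncomm_ring
          _ = x * a * (y * x) * b * y := by rw [hyx]
          _ = _ := by noncomm_ring) }
  obtain ⟨d, hd0, hd⟩ := exists_ne_zero_forall_map_mul_eq σ (fun z hz => Subtype.ext (by
    change x * (z : D) * y = z
    rw [← hcomm z ⟨fun a ha => congrArg Subtype.val (Subring.mem_center_iff.1 hz ⟨a, ha⟩), z.2⟩,
      mul_assoc, hxy, mul_one]))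
  exact ⟨d, d.2, fun h => hd0 (Subtype.ext h), fun a ha => congrArg Subtype.val (hd ⟨a, ha⟩)⟩

/-- A maximal graded subfield of a centralizer contains every homogeneous element of that
centralizer commuting with it. -/
lemma IsMaxGradedSubfieldOf.mem_of_commute (hD : IsGradedDivisionRing 𝒜) {B T : Subring D}
    (hT : IsMaxGradedSubfieldOf 𝒜 (Subring.centralizer (B : Set D)) T) {γ : Γ} {c : D}
    (hc : c ∈ 𝒜 γ) (hcB : c ∈ Subring.centralizer (B : Set D))
    (hcT : c ∈ Subring.centralizer (T : Set D)) : c ∈ T := by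
  obtain ⟨⟨⟨hTgr, -⟩, hTcomm⟩, hTB, hmax⟩ := hT
  let S : Set D := insert c (T : Set D)
  let T' : Subring D := Subring.centralizer (Subring.centralizer S : Set D)
  have hST' : S ⊆ T' := Set.subset_centralizer_centralizer
  have hSgr : ∀ s ∈ S, ∀ δ : Γ, (DirectSum.decompose 𝒜 s δ : D) ∈ S := by
    rintro s (rfl | hs) δ
    · by_cases hδ : γ = δ
      · subst hδ
        rw [DirectSum.decompose_of_mem_same 𝒜 hc]
        exact Or.inl rfl
      · rw [DirectSum.decompose_of_mem_ne 𝒜 hc hδ]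
        exact Or.inr T.zero_mem
    · exact Or.inr (hTgr s hs δ)
  have hSS : S ⊆ Subring.centralizer S := by
    rintro s (rfl | hs) t (rfl | ht)
    exacts [rfl, hcT t ht, (hcT s hs).symm, hTcomm t ht s hs]
  have hBS : (B : Set D) ⊆ Subring.centralizer S := by
    rintro a ha s (rfl | hs)
    exacts [(hcB a ha).symm, (hTB hs a ha).symm]
  have hT' : IsGradedSubfield 𝒜 T' := by
    refine ⟨⟨isGradedSubring_centralizer 𝒜 (isGradedSubring_centralizer 𝒜 hSgr), ?_⟩, ?_⟩
    · intro δ x hxT' hx hx0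
      obtain ⟨y, -, hxy, hyx⟩ := hD.exists_inverse hx hx0
      refine ⟨y, fun s hs => ?_, hxy, hyx⟩
      calc s * y = y * (x * s) * y := by rw [← mul_assoc, hyx, one_mul]
        _ = y * s := by rw [← hxT' s hs, mul_assoc, mul_assoc, hxy, mul_one]
    · intro x hx y hy
      exact hy x (Subring.centralizer_le _ _ hSS hx)
  have hle : T' ≤ Subring.centralizer (B : Set D) := Subring.centralizer_le _ _ hBS
  rw [← hmax T' hT' hle fun t ht => hST' (Or.inr ht)]
  exact hST' (Or.inl rfl)

end Graded

/-- for every maximal graded subfield `T` of `𝖢`, the grade group of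
`C_𝖤(T)` equals `Γ_T`. -/
theorem stmt_8 {Γ : Type*} [AddCommGroup Γ] [DecidableEq Γ] {D : Type*} [Ring D]
    (hΓ : TorsionFree Γ) (𝒜 : Γ → AddSubgroup D) [GradedRing 𝒜]
    (hD : IsGradedDivisionRing 𝒜)
    (F : Subring D) (hFcen : F = Subring.center D) (hfin : finiteOver F)
    (T : Subring D) (hT : IsMaxGradedSubfieldOf 𝒜 (Cc 𝒜 F) T) :
    gradeSet 𝒜 (Subring.centralizer (T : Set D) ⊓ Ec 𝒜 F) = gradeSet 𝒜 T := by
  subst hFcen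
  have hTC := hT.2.1
  have hgrade0 : ∀ a ∈ 𝒜 0, a ∈ Uc 𝒜 (Subring.center D) := fun a ha =>
    (le_sup_left : grade0 𝒜 ≤ _) ha
  ext γ
  constructor
  · rintro ⟨x, ⟨hxT, hxE⟩, hx, hx0⟩
    obtain ⟨y, hy, hxy, hyx⟩ := hD.exists_inverse hx hx0
    obtain ⟨d, hd, hd0, hconj⟩ := hD.exists_grade0_conj hfin hx hy hxy hyx
      fun z hz => hxE z ((le_sup_left : _ ≤ Zc 𝒜 (Subring.center D)) hz)
    obtain ⟨e, he, hde, hed⟩ := hD.exists_inverse hd hd0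
    rw [neg_zero] at he
    have hc : e * x ∈ 𝒜 γ := by simpa using SetLike.mul_mem_graded he hx
    have hc0 : e * x ≠ 0 := fun h => hx0 (by
      rw [← one_mul x, ← hde, mul_assoc, h, mul_zero])
    have hcgrade0 : ∀ a ∈ 𝒜 0, a * (e * x) = e * x * a := fun a ha => by
      have h : d * a * e = x * a * y := by rw [← hconj a ha, mul_assoc, hde, mul_one]
      calc a * (e * x) = e * (d * a * e) * x := by
            rw [← mul_assoc, ← mul_assoc, ← mul_assoc, hed, one_mul]
        _ = e * x * a * (y * x) := by rw [h]; simp only [mul_assoc]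
        _ = e * x * a := by rw [hyx, mul_one]
    have hcU : e * x ∈ Subring.centralizer (Uc 𝒜 (Subring.center D) : Set D) := by
      have hU : Uc 𝒜 (Subring.center D) ≤ Subring.centralizer {e * x} := by
        refine sup_le (fun a ha => ?_) (Subring.center_le_centralizer _)
        rintro _ rfl
        exact (hcgrade0 a ha).symm
      exact fun a ha => (hU ha _ rfl).symm
    have hcT : e * x ∈ Subring.centralizer (T : Set D) :=
      mul_mem (fun t ht => (hTC ht e (hgrade0 e he)).symm) hxT
    exact ⟨e * x, hT.mem_of_commute hD hc hcU hcT, hc, hc0⟩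
  · rintro ⟨x, hxT, hx, hx0⟩
    have hZU : Zc 𝒜 (Subring.center D) ≤ Uc 𝒜 (Subring.center D) :=
      sup_le_sup_right inf_le_right _
    exact ⟨x, ⟨fun t ht => hT.1.2 t ht x hxT, fun z hz => hTC hxT z (hZU hz)⟩, hx, hx0⟩

end GradedDivPaper
end
end
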